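/- Fix an integer n ≥ 1, a vector x ∈ ℝⁿ, and a real number p > 2. Then for every positive integer S, R(S) ≤ ( 4 e^{1 + 1/e} · S · F_{2p−2} )^{S/2}, where e is Euler's number and F_{2p−2} = Σ_{i=1}^n |x_i|^{2p−2}. -/

import Mathlib

open Finset

/-- `R(S) = Σ_{q=1}^{⌊S/2⌋} Σ_{compositions (h₁,…,h_q) of S with parts ≥ 2}
[S!/(h₁!⋯h_q!)] · Σ_{i₁<⋯<i_q} ∏_r |x_{i_r}|^{(p−1)h_r} · ∏_r h_r^{h_r/2}`.
Compositions of `S` into `q` parts are functions `Fin q → ℕ` with the indicated sum;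
`q`-element subsets of `{1,…,n}` are given by their increasing enumerations, i.e. the
strictly monotone maps `Fin q → Fin n`. -/
noncomputable def Rsum (n : ℕ) (x : Fin n → ℝ) (p : ℝ) (S : ℕ) : ℝ :=
  ∑ q ∈ Finset.Icc 1 (S / 2),
    ∑ h ∈ (Fintype.piFinset fun _ : Fin q => Finset.range (S + 1)).filter
        (fun h => (∑ r, h r) = S ∧ ∀ r, 2 ≤ h r),
      ∑ i ∈ (Finset.univ : Finset (Fin q → Fin n)).filter
          (fun i => ∀ a b : Fin q, a < b → i a < i b),
        ((S.factorial : ℝ) / ∏ r, ((h r).factorial : ℝ)) *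
          ((∏ r, |x (i r)| ^ ((p - 1) * (h r : ℝ))) *
            ∏ r, (h r : ℝ) ^ ((h r : ℝ) / 2))

/-- `Q(S₁,S₂) = Σ_{q=1}^{min(S₁,S₂)} Σ_{compositions (e) of S₁, parts ≥ 1}
Σ_{compositions (g) of S₂, parts ≥ 1} [S₁!/(e₁!⋯e_q!)]·[S₂!/(g₁!⋯g_q!)] ·
Σ_{i₁<⋯<i_q} ∏_r |x_{i_r}|^{(p−1)(e_r+g_r)} · ∏_r (e_r+g_r)^{(e_r+g_r)/2}`. -/
noncomputable def Qsum (n : ℕ) (x : Fin n → ℝ) (p : ℝ) (S₁ S₂ : ℕ) : ℝ :=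
  ∑ q ∈ Finset.Icc 1 (min S₁ S₂),
    ∑ e ∈ (Fintype.piFinset fun _ : Fin q => Finset.range (S₁ + 1)).filter
        (fun e => (∑ r, e r) = S₁ ∧ ∀ r, 1 ≤ e r),
      ∑ g ∈ (Fintype.piFinset fun _ : Fin q => Finset.range (S₂ + 1)).filter
          (fun g => (∑ r, g r) = S₂ ∧ ∀ r, 1 ≤ g r),
        ∑ i ∈ (Finset.univ : Finset (Fin q → Fin n)).filter
            (fun i => ∀ a b : Fin q, a < b → i a < i b),
          ((S₁.factorial : ℝ) / ∏ r, ((e r).factorial : ℝ)) *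
            ((S₂.factorial : ℝ) / ∏ r, ((g r).factorial : ℝ)) *
            ((∏ r, |x (i r)| ^ ((p - 1) * ((e r + g r : ℕ) : ℝ))) *
              ∏ r, ((e r + g r : ℕ) : ℝ) ^ (((e r + g r : ℕ) : ℝ) / 2))

/-- `P(S) = Σ_{q=1}^{S} Σ_{compositions (e₁,…,e_q) of 2S with parts ≥ 2}
[S!/(Γ(e₁/2+1)⋯Γ(e_q/2+1))] · Σ_{i₁<⋯<i_q} ∏_r |x_{i_r}|^{(2p−2)(e_r/2)}`. -/
noncomputable def Psum (n : ℕ) (x : Fin n → ℝ) (p : ℝ) (S : ℕ) : ℝ :=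
  ∑ q ∈ Finset.Icc 1 S,
    ∑ e ∈ (Fintype.piFinset fun _ : Fin q => Finset.range (2 * S + 1)).filter
        (fun e => (∑ r, e r) = 2 * S ∧ ∀ r, 2 ≤ e r),
      ∑ i ∈ (Finset.univ : Finset (Fin q → Fin n)).filter
          (fun i => ∀ a b : Fin q, a < b → i a < i b),
        ((S.factorial : ℝ) / ∏ r, Real.Gamma ((e r : ℝ) / 2 + 1)) *
          ∏ r, |x (i r)| ^ ((2 * p - 2) * ((e r : ℝ) / 2))

/-- The coefficient `h^{h/2} / h!` attached to a part of size `h`. -/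
noncomputable def partWeight (h : ℕ) : ℝ :=
  (h : ℝ) ^ ((h : ℝ) / 2) / (h.factorial : ℝ)

lemma partWeight_nonneg (h : ℕ) : 0 ≤ partWeight h := by
  unfold partWeight; positivity

lemma rpow_half_even (m : ℕ) :
    ((2 * m : ℕ) : ℝ) ^ (((2 * m : ℕ) : ℝ) / 2) = (2 * (m : ℝ)) ^ m := by
  have h : ((2 * m : ℕ) : ℝ) / 2 = (m : ℝ) := by push_cast; ring
  rw [h, Real.rpow_natCast]
  push_cast
  rfl

lemma rpow_half_odd_le (m : ℕ) :
    ((2 * m + 1 : ℕ) : ℝ) ^ (((2 * m + 1 : ℕ) : ℝ) / 2)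
      ≤ (2 * (m : ℝ) + 1) ^ m * (m + 1) := by
  have h : ((2 * m + 1 : ℕ) : ℝ) / 2 = (m : ℝ) + 1 / 2 := by push_cast; ring
  have hpos : (0 : ℝ) < ((2 * m + 1 : ℕ) : ℝ) := by positivity
  rw [h, Real.rpow_add hpos, Real.rpow_natCast, ← Real.sqrt_eq_rpow]
  push_cast
  gcongr
  rw [Real.sqrt_le_left (by positivity)]
  nlinarith [sq_nonneg (m : ℝ)]

lemma factorial_two_mul_add_one_ge (m : ℕ) :
    ((m + 1).factorial : ℝ) * ((m : ℝ) + 2) ^ m ≤ ((2 * m + 1).factorial : ℝ) := by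
  have h := Nat.factorial_mul_pow_le_factorial (m := m + 1) (n := m)
  rw [show m + 1 + m = 2 * m + 1 by ring] at h
  exact_mod_cast h

lemma pow_div_factorial_le (m : ℕ) {a : ℝ} (ha : 0 ≤ a) (ham : a ≤ 2 * ((m : ℝ) + 2)) :
    a ^ m / ((2 * m + 1).factorial : ℝ) ≤ 2 ^ m / ((m + 1).factorial : ℝ) := by
  rw [div_le_div_iff₀ (by positivity) (by positivity)]
  calc a ^ m * ((m + 1).factorial : ℝ)
      ≤ (2 * ((m : ℝ) + 2)) ^ m * ((m + 1).factorial : ℝ) := by gcongr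
    _ = 2 ^ m * (((m + 1).factorial : ℝ) * ((m : ℝ) + 2) ^ m) := by rw [mul_pow]; ring
    _ ≤ _ := by gcongr; exact factorial_two_mul_add_one_ge m

lemma partWeight_even_le (m : ℕ) :
    partWeight (2 * m + 2) ≤ 2 ^ m / ((m + 1).factorial : ℝ) := by
  have h := pow_div_factorial_le m (a := 2 * (m : ℝ) + 2) (by positivity) (by linarith)
  refine le_trans (le_of_eq ?_) h
  rw [partWeight, show 2 * m + 2 = 2 * (m + 1) by ring, rpow_half_even,
    show 2 * (m + 1) = (2 * m + 1) + 1 by ring, Nat.factorial_succ (2 * m + 1)]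
  have := Nat.factorial_pos (2 * m + 1)
  push_cast
  field_simp
  ring

lemma partWeight_odd_le (m : ℕ) :
    partWeight (2 * m + 1) ≤ ((m : ℝ) + 1) * (2 ^ m / ((m + 1).factorial : ℝ)) := by
  have h := pow_div_factorial_le m (a := 2 * (m : ℝ) + 1) (by positivity) (by linarith)
  calc partWeight (2 * m + 1)
      ≤ ((2 * (m : ℝ) + 1) ^ m * (m + 1)) / ((2 * m + 1).factorial : ℝ) := by
        unfold partWeight; gcongr; exact rpow_half_odd_le m
    _ = ((m : ℝ) + 1) * ((2 * (m : ℝ) + 1) ^ m / ((2 * m + 1).factorial : ℝ)) := by ring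
    _ ≤ _ := by gcongr

lemma partWeight_odd_le' (m : ℕ) :
    partWeight (2 * m + 3) ≤ 2 ^ m / ((m + 1).factorial : ℝ) := by
  have h := pow_div_factorial_le m (a := 2 * (m : ℝ) + 3) (by positivity) (by linarith)
  have hodd := rpow_half_odd_le (m + 1)
  rw [show 2 * (m + 1) + 1 = 2 * m + 3 by ring] at hodd
  push_cast at hodd
  have hf : ((2 * m + 3).factorial : ℝ)
      = (2 * m + 3) * ((2 * m + 2) * ((2 * m + 1).factorial : ℝ)) := by
    rw [Nat.factorial_succ (2 * m + 2), Nat.factorial_succ (2 * m + 1)]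
    push_cast; ring
  refine le_trans ?_ h
  rw [partWeight, hf, div_le_div_iff₀ (by positivity) (by positivity)]
  push_cast
  calc _ ≤ (2 * ((m : ℝ) + 1) + 1) ^ (m + 1) * ((m : ℝ) + 1 + 1)
        * ((2 * m + 1).factorial : ℝ) := by gcongr
    _ = (2 * (m : ℝ) + 3) ^ m * ((2 * m + 3) * ((m + 2) * ((2 * m + 1).factorial : ℝ))) := by
        rw [pow_succ]; ring
    _ ≤ _ := by gcongr; linarith

lemma two_pow_mul_le (m : ℕ) : (2 : ℝ) ^ m * (m + 4) / 2 ≤ (5 / 2) ^ (m + 1) := by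
  induction m with
  | zero => norm_num
  | succ k ih =>
    rw [pow_succ (5 / 2 : ℝ) (k + 1), pow_succ (2 : ℝ) k]
    push_cast
    have : (0 : ℝ) ≤ 2 ^ k * k := by positivity
    nlinarith

lemma partWeight_window_le (m : ℕ) :
    partWeight (2 * m + 2) + partWeight (2 * m + 1) / 2 + partWeight (2 * m + 3) / 2
      ≤ (5 / 2) ^ (m + 1) / ((m + 1).factorial : ℝ) := by
  calc _ ≤ 2 ^ m / ((m + 1).factorial : ℝ)
        + ((m : ℝ) + 1) * (2 ^ m / ((m + 1).factorial : ℝ)) / 2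
        + 2 ^ m / ((m + 1).factorial : ℝ) / 2 := by
        gcongr
        · exact partWeight_even_le m
        · exact partWeight_odd_le m
        · exact partWeight_odd_le' m
    _ = (2 ^ m * (m + 4) / 2) / ((m + 1).factorial : ℝ) := by ring
    _ ≤ _ := by gcongr; exact two_pow_mul_le m

lemma one_add_sum_partWeight_le (u : ℝ) (hu : 0 ≤ u) (m : ℕ) :
    1 + ∑ h ∈ Ico 2 (2 * m + 2), partWeight h * u ^ h
      ≤ ∑ k ∈ range (m + 1), (5 / 2 * u ^ 2) ^ k / (k.factorial : ℝ)
        + partWeight (2 * m + 1) / 2 * u ^ (2 * m + 2) := by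
  induction m with
  | zero =>
    have := partWeight_nonneg 1
    simp
    positivity
  | succ m ih =>
    rw [show 2 * (m + 1) + 2 = (2 * m + 2) + 1 + 1 by ring,
      sum_Ico_succ_top (by omega), sum_Ico_succ_top (by omega), sum_range_succ _ (m + 1)]
    have hw := mul_le_mul_of_nonneg_right (partWeight_window_le m)
      (by positivity : 0 ≤ u ^ (2 * m + 2))
    have hpow : (5 / 2 * u ^ 2) ^ (m + 1) / ((m + 1).factorial : ℝ)
        = (5 / 2) ^ (m + 1) / ((m + 1).factorial : ℝ) * u ^ (2 * m + 2) := by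
      rw [mul_pow, ← pow_mul, show 2 * (m + 1) = 2 * m + 2 by ring]; ring
    have hamgm : u ^ (2 * m + 2 + 1) ≤ (u ^ (2 * m + 2) + u ^ (2 * m + 2 + 1 + 1)) / 2 := by
      rw [pow_succ u (2 * m + 2 + 1), pow_succ u (2 * m + 2)]
      nlinarith [mul_nonneg (by positivity : 0 ≤ u ^ (2 * m + 2)) (sq_nonneg (u - 1))]
    have hodd := mul_le_mul_of_nonneg_left hamgm (partWeight_nonneg (2 * m + 3))
    rw [hpow, show 2 * (m + 1) + 1 = 2 * m + 3 by ring]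
    rw [show 2 * m + 2 + 1 = 2 * m + 3 by ring] at hodd ⊢
    linarith

/-- Gaussian bound for the generating polynomial of a single coordinate. -/
lemma one_add_sum_partWeight_le_exp (u : ℝ) (hu : 0 ≤ u) (S : ℕ) :
    1 + ∑ h ∈ Icc 2 S, partWeight h * u ^ h ≤ Real.exp (5 / 2 * u ^ 2) := by
  have hpart : partWeight (2 * S + 1) / 2 ≤ (5 / 2) ^ (S + 1) / ((S + 1).factorial : ℝ) := by
    linarith [partWeight_window_le S, partWeight_nonneg (2 * S + 2),
      partWeight_nonneg (2 * S + 3)]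
  calc 1 + ∑ h ∈ Icc 2 S, partWeight h * u ^ h
      ≤ 1 + ∑ h ∈ Ico 2 (2 * S + 2), partWeight h * u ^ h := by
        refine add_le_add_right (sum_le_sum_of_subset_of_nonneg ?_ ?_) 1
        · intro h hh
          simp only [mem_Icc, mem_Ico] at hh ⊢
          omega
        · intro h _ _
          exact mul_nonneg (partWeight_nonneg h) (by positivity)
    _ ≤ _ := one_add_sum_partWeight_le u hu S
    _ ≤ ∑ k ∈ range (S + 1), (5 / 2 * u ^ 2) ^ k / (k.factorial : ℝ)
        + (5 / 2) ^ (S + 1) / ((S + 1).factorial : ℝ) * u ^ (2 * S + 2) := by gcongr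
    _ = ∑ k ∈ range (S + 2), (5 / 2 * u ^ 2) ^ k / (k.factorial : ℝ) := by
        rw [sum_range_succ _ (S + 1), mul_pow, ← pow_mul, show 2 * (S + 1) = 2 * S + 2 by ring]
        ring
    _ ≤ _ := Real.sum_le_exp_of_nonneg (by positivity) _

/-- Sums over increasing enumerations of subsets are bounded by the full product. -/
lemma sum_strictMono_prod_le (n : ℕ) (g : Fin n → ℝ) (hg : ∀ i, 0 ≤ g i) (T : Finset ℕ) :
    ∑ q ∈ T, ∑ i ∈ (univ : Finset (Fin q → Fin n)).filter
        (fun i => ∀ a b : Fin q, a < b → i a < i b), ∏ r, g (i r)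
      ≤ ∏ i, (1 + g i) := by
  have hq : ∀ q, ∑ i ∈ (univ : Finset (Fin q → Fin n)).filter
        (fun i => ∀ a b : Fin q, a < b → i a < i b), ∏ r, g (i r)
      ≤ ∑ A ∈ (univ : Finset (Finset (Fin n))) with A.card = q, ∏ a ∈ A, g a := by
    intro q
    have hmono : ∀ i ∈ (univ : Finset (Fin q → Fin n)).filter
        (fun i => ∀ a b : Fin q, a < b → i a < i b), StrictMono i :=
      fun i hi a b hab => (mem_filter.1 hi).2 a b hab
    have hinj : Set.InjOn (fun i : Fin q → Fin n => univ.image i)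
        ((univ : Finset (Fin q → Fin n)).filter
          (fun i => ∀ a b : Fin q, a < b → i a < i b)) := by
      intro i hi j hj hij
      have hij' : univ.image i = univ.image j := hij
      refine (StrictMono.range_inj (hmono i hi) (hmono j hj)).1 ?_
      simpa using congrArg (fun A : Finset (Fin n) => (A : Set (Fin n))) hij'
    calc _ = ∑ i ∈ (univ : Finset (Fin q → Fin n)).filter
            (fun i => ∀ a b : Fin q, a < b → i a < i b), ∏ a ∈ univ.image i, g a := by
          refine sum_congr rfl fun i hi => ?_
          rw [prod_image ((hmono i hi).injective.injOn)]
      _ = ∑ A ∈ Finset.image (fun i : Fin q → Fin n => univ.image i)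
            ((univ : Finset (Fin q → Fin n)).filter
              (fun i => ∀ a b : Fin q, a < b → i a < i b)),
          ∏ a ∈ A, g a := (sum_image (f := fun A => ∏ a ∈ A, g a) hinj).symm
      _ ≤ _ := by
          apply sum_le_sum_of_subset_of_nonneg
          · intro A hA
            obtain ⟨i, hi, rfl⟩ := mem_image.1 hA
            simp [card_image_of_injective _ (hmono i hi).injective]
          · intro A _ _
            exact prod_nonneg fun a _ => hg a
  calc _ ≤ ∑ q ∈ T, ∑ A ∈ (univ : Finset (Finset (Fin n))) with A.card = q, ∏ a ∈ A, g a :=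
        sum_le_sum fun q _ => hq q
    _ ≤ ∑ A : Finset (Fin n), ∏ a ∈ A, g a :=
        sum_fiberwise_le_sum_of_sum_fiber_nonneg fun q _ =>
          sum_nonneg fun A _ => prod_nonneg fun a _ => hg a
    _ = _ := by rw [prod_one_add, powerset_univ]

/-- Chernoff-type bound for `Rsum` with a free parameter `t`. -/
lemma Rsum_le_factorial_mul_exp (n : ℕ) (x : Fin n → ℝ) (p : ℝ) (S : ℕ) (t : ℝ) (ht : 0 < t) :
    Rsum n x p S ≤ S.factorial / t ^ S
      * Real.exp (5 / 2 * (t ^ 2 * ∑ i, |x i| ^ (2 * p - 2))) := by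
  set y : Fin n → ℝ := fun i => |x i| ^ (p - 1) with hy
  have hy0 : ∀ i, 0 ≤ y i := fun i => by positivity
  set g : Fin n → ℝ := fun i => ∑ h ∈ Icc 2 S, partWeight h * (y i * t) ^ h with hg
  have hterm : ∀ i h, 0 ≤ partWeight h * (y i * t) ^ h := fun i h =>
    mul_nonneg (partWeight_nonneg h) (pow_nonneg (mul_nonneg (hy0 i) ht.le) h)
  have hg0 : ∀ i, 0 ≤ g i := fun i => sum_nonneg fun h _ => hterm i h
  have hR : Rsum n x p S ≤ ∑ q ∈ Icc 1 (S / 2), ∑ i ∈ (univ : Finset (Fin q → Fin n)).filter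
        (fun i => ∀ a b : Fin q, a < b → i a < i b), S.factorial / t ^ S * ∏ r, g (i r) := by
    refine sum_le_sum fun q _ => ?_
    rw [sum_comm]
    refine sum_le_sum fun i _ => ?_
    rw [hg, prod_univ_sum, mul_sum]
    calc _ = ∑ h ∈ (Fintype.piFinset fun _ : Fin q => range (S + 1)).filter
            (fun h => (∑ r, h r) = S ∧ ∀ r, 2 ≤ h r),
            S.factorial / t ^ S * ∏ r, partWeight (h r) * (y (i r) * t) ^ h r := by
          refine sum_congr rfl fun h hh => ?_
          have hsum := (mem_filter.1 hh).2.1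
          have hpow : ∏ r, t ^ h r = t ^ S := by rw [prod_pow_eq_pow_sum, hsum]
          have hx : ∀ r, |x (i r)| ^ ((p - 1) * (h r : ℝ)) = y (i r) ^ h r := fun r => by
            rw [Real.rpow_mul (abs_nonneg _), Real.rpow_natCast]
          simp only [partWeight, mul_pow, prod_mul_distrib, prod_div_distrib, hpow, hx]
          field_simp
      _ ≤ _ := by
          apply sum_le_sum_of_subset_of_nonneg
          · intro h hh
            simp only [mem_filter, Fintype.mem_piFinset, mem_range] at hh
            simp only [Fintype.mem_piFinset, mem_Icc]
            exact fun r => ⟨hh.2.2 r, Nat.lt_succ_iff.1 (hh.1 r)⟩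
          · intro h _ _
            exact mul_nonneg (by positivity) (prod_nonneg fun r _ => hterm _ _)
  refine hR.trans ?_
  simp only [← mul_sum]
  gcongr
  calc _ ≤ ∏ i, (1 + g i) := sum_strictMono_prod_le n g hg0 _
    _ ≤ ∏ i, Real.exp (5 / 2 * (y i * t) ^ 2) :=
        prod_le_prod (fun i _ => by linarith [hg0 i]) fun i _ =>
          one_add_sum_partWeight_le_exp _ (mul_nonneg (hy0 i) ht.le) S
    _ = _ := by
        rw [← Real.exp_sum]
        congr 1
        rw [mul_sum, mul_sum]
        refine sum_congr rfl fun i _ => ?_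
        have : |x i| ^ (2 * p - 2) = y i ^ 2 := by
          rw [hy, ← Real.rpow_natCast, ← Real.rpow_mul (abs_nonneg _)]
          congr 1; push_cast; ring
        rw [this]; ring

lemma Rsum_eq_zero_of_forall_eq_zero (n : ℕ) (x : Fin n → ℝ) (p : ℝ) (hp : p ≠ 1) (S : ℕ)
    (hx : ∀ i, x i = 0) : Rsum n x p S = 0 := by
  refine sum_eq_zero fun q hq => sum_eq_zero fun h hh => sum_eq_zero fun i _ => ?_
  have hq1 : 0 < q := (mem_Icc.1 hq).1
  have h2 := (mem_filter.1 hh).2.2 ⟨0, hq1⟩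
  have hne : (p - 1) * (h ⟨0, hq1⟩ : ℝ) ≠ 0 :=
    mul_ne_zero (sub_ne_zero.2 hp) (Nat.cast_ne_zero.2 (by omega))
  have hzero : ∏ r, |x (i r)| ^ ((p - 1) * (h r : ℝ)) = 0 :=
    prod_eq_zero (mem_univ (⟨0, hq1⟩ : Fin q)) (by rw [hx, abs_zero, Real.zero_rpow hne])
  rw [hzero, zero_mul, mul_zero]

lemma five_mul_exp_one_le : 5 * Real.exp 1 ≤ 4 * Real.exp (1 + 1 / Real.exp 1) := by
  have he : Real.exp 1 ≤ 4 := by linarith [Real.exp_one_lt_d9]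
  have h1 : (1 : ℝ) / 4 ≤ 1 / Real.exp 1 := one_div_le_one_div_of_le (Real.exp_pos 1) he
  have h2 := Real.add_one_le_exp (1 / Real.exp 1)
  rw [Real.exp_add]
  nlinarith [Real.exp_pos 1]

/-- `R(S) ≤ (4 e^{1 + 1/e} S F_{2p−2})^{S/2}`, where `F_{2p−2} = Σ_i |x_i|^{2p−2}`
and `e` is Euler's number. -/
theorem Rsum_le_moment_rpow (n : ℕ) (hn : 1 ≤ n) (x : Fin n → ℝ) (p : ℝ)
    (hp : 2 < p) (S : ℕ) (hS : 0 < S) :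
    Rsum n x p S
      ≤ (4 * Real.exp (1 + 1 / Real.exp 1) * (S : ℝ) * ∑ i, |x i| ^ (2 * p - 2))
          ^ ((S : ℝ) / 2) := by
  by_cases hx : ∀ i, x i = 0
  · rw [Rsum_eq_zero_of_forall_eq_zero n x p (by linarith) S hx]
    positivity
  push Not at hx
  obtain ⟨i₀, hi₀⟩ := hx
  have hF : 0 < ∑ i, |x i| ^ (2 * p - 2) :=
    sum_pos' (fun i _ => by positivity)
      ⟨i₀, mem_univ _, Real.rpow_pos_of_pos (abs_pos.2 hi₀) _⟩
  set F := ∑ i, |x i| ^ (2 * p - 2) with hFdef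
  have hS' : (0 : ℝ) < S := Nat.cast_pos.2 hS
  set t := Real.sqrt (S / (5 * F)) with ht
  have ht0 : 0 < t := Real.sqrt_pos.2 (by positivity)
  have ht2 : t ^ 2 = S / (5 * F) := Real.sq_sqrt (by positivity)
  have htS : t ^ S = (S / (5 * F)) ^ ((S : ℝ) / 2) := by
    rw [ht, Real.sqrt_eq_rpow, ← Real.rpow_natCast, ← Real.rpow_mul (by positivity)]
    congr 1; ring
  have hSS : (S : ℝ) ^ S = ((S : ℝ) ^ 2) ^ ((S : ℝ) / 2) := by
    rw [← Real.rpow_natCast, ← Real.rpow_natCast, ← Real.rpow_mul hS'.le]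
    congr 1; push_cast; ring
  have hexp : Real.exp (5 / 2 * (t ^ 2 * F)) = Real.exp 1 ^ ((S : ℝ) / 2) := by
    rw [Real.exp_one_rpow, ht2]
    congr 1; field_simp
  calc Rsum n x p S ≤ S.factorial / t ^ S * Real.exp (5 / 2 * (t ^ 2 * F)) :=
        Rsum_le_factorial_mul_exp n x p S t ht0
    _ ≤ (S : ℝ) ^ S / t ^ S * Real.exp (5 / 2 * (t ^ 2 * F)) := by
        gcongr; exact_mod_cast Nat.factorial_le_pow S
    _ = (5 * Real.exp 1 * S * F) ^ ((S : ℝ) / 2) := by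
        rw [hSS, htS, hexp, ← Real.div_rpow (by positivity) (by positivity),
          ← Real.mul_rpow (by positivity) (by positivity)]
        congr 1; field_simp
    _ ≤ _ := by gcongr (?_ * _ * _) ^ _; exact five_mul_exp_one_le
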